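/- arXiv:1411.7765 — 4 statements merged into one kernel-verified Lean document; each statement's English description precedes it below -/
import Mathlib

section
/- Let F, G ∈ L¹(ℝ^n) with F ≥ 0, G ≥ 0 and ∫_{ℝ^n} F(x) dx = ∫_{ℝ^n} G(x) dx = 1, and let μ be a positive Borel measure on ℝ^n such that F∗μ ≤ 1 almost everywhere and G∗μ ≤ 1 almost everywhere. Then F∗μ = 1 almost everywhere if and only if G∗μ = 1 almost everywhere. -/
open MeasureTheory Set
open scoped ENNReal

noncomputable section

/-- the convolution `(f ∗ μ)(x) = ∫ f(x-y) dμ(y)` of a nonnegative function with a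
positive Borel measure, as a lower Lebesgue integral. -/
def convMeas {n : ℕ} (f : (Fin n → ℝ) → ℝ) (μ : Measure (Fin n → ℝ)) :
    (Fin n → ℝ) → ℝ≥0∞ :=
  fun x => ∫⁻ y, ENNReal.ofReal (f (x - y)) ∂μ

/-- The sets on which `μ` is s-finite are stable under countable unions. -/
lemma sFinite_restrict_iUnion {α : Type*} [MeasurableSpace α] {μ : Measure α}
    {T : ℕ → Set α} (hT : ∀ n, MeasurableSet (T n)) (h : ∀ n, SFinite (μ.restrict (T n))) :
    SFinite (μ.restrict (⋃ n, T n)) := by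
  have hd : ∀ n, MeasurableSet (disjointed T n) := fun n => MeasurableSet.disjointed hT n
  rw [← iUnion_disjointed, Measure.restrict_iUnion (disjoint_disjointed T) hd]
  have : ∀ n, SFinite (μ.restrict (disjointed T n)) := fun n => by
    rw [← Measure.restrict_restrict_of_subset (disjointed_subset T n)]
    infer_instance
  infer_instance

/-- Exhaustion: if a positive density `k` has bounded mass on all sets on which `μ` is s-finite,
then there is an essentially largest such set. -/
lemma exists_maximal_sFinite_restrict {α : Type*} [MeasurableSpace α] (μ : Measure α)
    {k : α → ℝ≥0∞} (hk : Measurable k) (hk0 : ∀ y, k y ≠ 0) {C : ℝ≥0∞} (hC : C ≠ ∞)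
    (h : ∀ T, MeasurableSet T → SFinite (μ.restrict T) → ∫⁻ y in T, k y ∂μ ≤ C) :
    ∃ S, MeasurableSet S ∧ SFinite (μ.restrict S) ∧
      ∀ T, MeasurableSet T → SFinite (μ.restrict T) → μ (T \ S) = 0 := by
  let 𝒯 : Set (Set α) := {T | MeasurableSet T ∧ SFinite (μ.restrict T)}
  let m : Set α → ℝ≥0∞ := fun T => ∫⁻ y in T, k y ∂μ
  have hne : (m '' 𝒯).Nonempty :=
    ⟨_, ∅, ⟨MeasurableSet.empty, by rw [Measure.restrict_empty]; infer_instance⟩, rfl⟩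
  obtain ⟨u, -, hu, hu𝒯⟩ := exists_seq_tendsto_sSup hne (OrderTop.bddAbove _)
  choose T hT hTu using hu𝒯
  have hS : MeasurableSet (⋃ n, T n) := MeasurableSet.iUnion fun n => (hT n).1
  have hSf := sFinite_restrict_iUnion (fun n => (hT n).1) fun n => (hT n).2
  refine ⟨⋃ n, T n, hS, hSf, fun R hR hRf => ?_⟩
  have hsup : sSup (m '' 𝒯) ≤ m (⋃ n, T n) := le_of_tendsto' hu fun n => by
    rw [← hTu n]
    exact lintegral_mono_set (subset_iUnion T n)
  have hD : MeasurableSet (R \ ⋃ n, T n) := hR.diff hS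
  have hDf : SFinite (μ.restrict (R \ ⋃ n, T n)) := by
    rw [← Measure.restrict_restrict_of_subset sdiff_subset]
    infer_instance
  have hdisj : Disjoint (⋃ n, T n) (R \ ⋃ n, T n) := disjoint_sdiff_right
  have hUf : SFinite (μ.restrict ((⋃ n, T n) ∪ (R \ ⋃ n, T n))) := by
    rw [Measure.restrict_union hdisj hD]
    infer_instance
  have hU : m (⋃ n, T n) + m (R \ ⋃ n, T n) ≤ m (⋃ n, T n) + 0 := by
    rw [add_zero, ← lintegral_union hD hdisj]
    exact (le_sSup (mem_image_of_mem m (show _ ∈ 𝒯 from ⟨hS.union hD, hUf⟩))).trans hsup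
  have hz : m (R \ ⋃ n, T n) = 0 := le_zero_iff.1
    ((ENNReal.add_le_add_iff_left (ne_top_of_le_ne_top hC (h _ hS hSf))).1 hU)
  have := (setLIntegral_eq_zero_iff hD hk).1 hz
  rw [measure_eq_zero_iff_ae_notMem]
  filter_upwards [this] with x hx hxD using hk0 x (hx hxD)

/-- A measure is s-finite on the set where an integrable function does not vanish. -/
lemma sFinite_restrict_ne_zero {α : Type*} [MeasurableSpace α] {μ : Measure α}
    {f : α → ℝ≥0∞} (hf : Measurable f) (hft : ∀ x, f x ≠ ∞) (hi : ∫⁻ x, f x ∂μ ≠ ∞) :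
    SFinite (μ.restrict {x | f x ≠ 0}) := by
  have hS : MeasurableSet {x | f x ≠ 0} := hf (measurableSet_singleton 0).compl
  rw [← withDensity_inv_same (μ := μ.restrict {x | f x ≠ 0}) hf (ae_restrict_mem hS)
    (Filter.Eventually.of_forall hft)]
  have : IsFiniteMeasure ((μ.restrict {x | f x ≠ 0}).withDensity f) :=
    isFiniteMeasure_withDensity (ne_top_of_le_ne_top hi (setLIntegral_le_lintegral _ _))
  infer_instance

lemma measurable_ofReal_sub {n : ℕ} {F : (Fin n → ℝ) → ℝ} (hF : Measurable F) :
    Measurable fun p : (Fin n → ℝ) × (Fin n → ℝ) => ENNReal.ofReal (F (p.1 - p.2)) :=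
  (hF.comp (measurable_fst.sub measurable_snd)).ennreal_ofReal

lemma measurable_ofReal_sub_left {n : ℕ} {F : (Fin n → ℝ) → ℝ} (hF : Measurable F)
    (x : Fin n → ℝ) : Measurable fun y => ENNReal.ofReal (F (x - y)) :=
  (measurable_ofReal_sub hF).comp measurable_prodMk_left

lemma measurable_ofReal_sub_right {n : ℕ} {F : (Fin n → ℝ) → ℝ} (hF : Measurable F)
    (y : Fin n → ℝ) : Measurable fun x => ENNReal.ofReal (F (x - y)) :=
  (measurable_ofReal_sub hF).comp measurable_prodMk_right

lemma measurable_convMeas {n : ℕ} {F : (Fin n → ℝ) → ℝ} (hF : Measurable F)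
    (μ : Measure (Fin n → ℝ)) [SFinite μ] : Measurable (convMeas F μ) :=
  (measurable_ofReal_sub hF).lintegral_prod_right'

lemma lintegral_ofReal_sub_left {n : ℕ} (F : (Fin n → ℝ) → ℝ) (y : Fin n → ℝ) :
    ∫⁻ x, ENNReal.ofReal (F (x - y)) = ∫⁻ x, ENNReal.ofReal (F x) :=
  lintegral_sub_right_eq_self (fun x => ENNReal.ofReal (F x)) y

lemma lintegral_ofReal_sub_right {n : ℕ} (F : (Fin n → ℝ) → ℝ) (x : Fin n → ℝ) :
    ∫⁻ y, ENNReal.ofReal (F (x - y)) = ∫⁻ x, ENNReal.ofReal (F x) :=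
  lintegral_sub_left_eq_self (fun x => ENNReal.ofReal (F x)) x

/-- If `F ∗ μ` is bounded, then `μ` has an essentially largest s-finite part. -/
lemma exists_maximal_sFinite_restrict_of_convMeas_le {n : ℕ} {F : (Fin n → ℝ) → ℝ}
    (hF : Measurable F) (hF1 : ∫⁻ x, ENNReal.ofReal (F x) = 1) (μ : Measure (Fin n → ℝ))
    (hFμ : ∀ᵐ x, convMeas F μ x ≤ 1) :
    ∃ S, MeasurableSet S ∧ SFinite (μ.restrict S) ∧
      ∀ T, MeasurableSet T → SFinite (μ.restrict T) → μ (T \ S) = 0 := by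
  obtain ⟨w, hw0, hw, hw1⟩ :=
    exists_pos_lintegral_lt_of_sigmaFinite (volume : Measure (Fin n → ℝ)) one_ne_zero
  have hm : Measurable fun p : (Fin n → ℝ) × (Fin n → ℝ) =>
      ENNReal.ofReal (F (p.1 - p.2)) * w p.1 :=
    (measurable_ofReal_sub hF).mul (hw.comp measurable_fst).coe_nnreal_ennreal
  refine exists_maximal_sFinite_restrict μ
    (k := fun y => ∫⁻ x, ENNReal.ofReal (F (x - y)) * w x) hm.lintegral_prod_left'
    (fun y hy => ?_) ENNReal.one_ne_top (fun T hT hTf => ?_)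
  · rw [lintegral_eq_zero_iff (by exact hm.comp measurable_prodMk_right)] at hy
    have : ∫⁻ x, ENNReal.ofReal (F (x - y)) = 0 := by
      rw [lintegral_eq_zero_iff (measurable_ofReal_sub_right hF _)]
      filter_upwards [hy] with x hx
      exact (mul_eq_zero.1 hx).resolve_right (by simpa using (hw0 x).ne')
    rw [lintegral_ofReal_sub_left, hF1] at this
    exact one_ne_zero this
  · rw [← lintegral_lintegral_swap hm.aemeasurable]
    refine le_trans (lintegral_mono_ae ?_) hw1.le
    filter_upwards [hFμ] with x hx
    rw [lintegral_mul_const _ (measurable_ofReal_sub_left hF _)]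
    exact (mul_le_mul_left ((setLIntegral_le_lintegral _ _).trans hx) _).trans_eq (one_mul _)

/-- Where `F ∗ μ` is finite, it only depends on the maximal s-finite part of `μ`. -/
lemma convMeas_restrict_eq {n : ℕ} {F : (Fin n → ℝ) → ℝ} (hF : Measurable F)
    {μ : Measure (Fin n → ℝ)} {S : Set (Fin n → ℝ)} (hS : MeasurableSet S)
    (hmax : ∀ T, MeasurableSet T → SFinite (μ.restrict T) → μ (T \ S) = 0)
    {x : Fin n → ℝ} (hx : convMeas F μ x ≤ 1) :
    convMeas F (μ.restrict S) x = convMeas F μ x := by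
  have hf : Measurable fun y => ENNReal.ofReal (F (x - y)) :=
    measurable_ofReal_sub_left hF x
  have h0 := hmax _ (hf (measurableSet_singleton 0).compl) (sFinite_restrict_ne_zero hf
    (fun _ => ENNReal.ofReal_ne_top) (ne_top_of_le_ne_top ENNReal.one_ne_top hx))
  unfold convMeas
  rw [← lintegral_add_compl (μ := μ) _ hS, (setLIntegral_eq_zero_iff hS.compl hf).2, add_zero]
  filter_upwards [measure_eq_zero_iff_ae_notMem.1 h0] with y hy hyS
  by_contra hne
  exact hy ⟨hne, hyS⟩

/-- Convolutions with `F` and `G` commute. -/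
lemma lintegral_mul_convMeas_comm {n : ℕ} {F G : (Fin n → ℝ) → ℝ} (hF : Measurable F)
    (hG : Measurable G) (μ : Measure (Fin n → ℝ)) [SFinite μ] (x : Fin n → ℝ) :
    ∫⁻ z, ENNReal.ofReal (F (x - z)) * convMeas G μ z =
      ∫⁻ z, ENNReal.ofReal (G (x - z)) * convMeas F μ z := by
  have key : ∀ {F G : (Fin n → ℝ) → ℝ}, Measurable F → Measurable G →
      ∫⁻ z, ENNReal.ofReal (F (x - z)) * convMeas G μ z =
        ∫⁻ y, ∫⁻ z, ENNReal.ofReal (F (x - z)) * ENNReal.ofReal (G (z - y)) ∂volume ∂μ := by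
    intro F G hF hG
    rw [← lintegral_lintegral_swap]
    · refine lintegral_congr fun z => ?_
      exact (lintegral_const_mul _ (measurable_ofReal_sub_left hG _)).symm
    · exact (((measurable_ofReal_sub hF).comp (measurable_const.prodMk measurable_fst)).mul
        (measurable_ofReal_sub hG)).aemeasurable
  rw [key hF hG, key hG hF]
  refine lintegral_congr fun y => ?_
  rw [← lintegral_sub_left_eq_self _ (x + y)]
  refine lintegral_congr fun z => ?_
  rw [mul_comm, show x - (x + y - z) = z - y by abel, show x + y - z - y = x - z by abel]

/-- If `F` has mass one, `u ≤ 1` and `F ∗ u = 1` almost everywhere, then `u = 1` almost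
everywhere. -/
lemma ae_eq_one_of_lintegral_mul_eq_one {n : ℕ} {F : (Fin n → ℝ) → ℝ} (hF : Measurable F)
    (hF1 : ∫⁻ x, ENNReal.ofReal (F x) = 1) {u : (Fin n → ℝ) → ℝ≥0∞} (hu : Measurable u)
    (hu1 : ∀ᵐ x, u x ≤ 1) (h : ∀ᵐ x, ∫⁻ z, ENNReal.ofReal (F (x - z)) * u z = 1) :
    ∀ᵐ x, u x = 1 := by
  have hm : Measurable fun p : (Fin n → ℝ) × (Fin n → ℝ) =>
      ENNReal.ofReal (F (p.1 - p.2)) * (1 - u p.2) :=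
    (measurable_ofReal_sub hF).mul (measurable_const.sub (hu.comp measurable_snd))
  have h0 : ∀ᵐ x, ∫⁻ z, ENNReal.ofReal (F (x - z)) * (1 - u z) = 0 := by
    filter_upwards [h] with x hx
    have hFx : Measurable fun z => ENNReal.ofReal (F (x - z)) :=
      measurable_ofReal_sub_left hF x
    have hadd : ∫⁻ z, ENNReal.ofReal (F (x - z)) * u z +
        ENNReal.ofReal (F (x - z)) * (1 - u z) = 1 := by
      refine (lintegral_congr_ae ?_).trans ((lintegral_ofReal_sub_right F x).trans hF1)
      filter_upwards [hu1] with z hz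
      rw [← mul_add, add_tsub_cancel_of_le hz, mul_one]
    rw [lintegral_add_left (by exact hFx.mul hu), hx] at hadd
    exact (ENNReal.add_right_inj ENNReal.one_ne_top).1 (hadd.trans (add_zero 1).symm)
  have h1 : ∫⁻ z, 1 - u z = 0 := by
    calc ∫⁻ z, 1 - u z
        = ∫⁻ z, ∫⁻ x, ENNReal.ofReal (F (x - z)) * (1 - u z) := by
          refine lintegral_congr fun z => ?_
          rw [lintegral_mul_const _ (measurable_ofReal_sub_right hF _),
            lintegral_ofReal_sub_left, hF1, one_mul]
      _ = ∫⁻ x, ∫⁻ z, ENNReal.ofReal (F (x - z)) * (1 - u z) :=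
          (lintegral_lintegral_swap hm.aemeasurable).symm
      _ = 0 := by rw [lintegral_congr_ae h0, lintegral_zero]
  rw [lintegral_eq_zero_iff (by exact measurable_const.sub hu)] at h1
  filter_upwards [h1, hu1] with x hx hx1 using le_antisymm hx1 (tsub_eq_zero_iff_le.1 hx)

lemma ae_convMeas_eq_one_of_sFinite {n : ℕ} {F G : (Fin n → ℝ) → ℝ}
    (hF : Measurable F) (hG : Measurable G)
    (hF1 : ∫⁻ x, ENNReal.ofReal (F x) = 1) (hG1 : ∫⁻ x, ENNReal.ofReal (G x) = 1)
    (μ : Measure (Fin n → ℝ)) [SFinite μ] (hGμ : ∀ᵐ x, convMeas G μ x ≤ 1)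
    (h : ∀ᵐ x, convMeas F μ x = 1) : ∀ᵐ x, convMeas G μ x = 1 := by
  refine ae_eq_one_of_lintegral_mul_eq_one hF hF1 (measurable_convMeas hG μ) hGμ
    (Filter.Eventually.of_forall fun x => ?_)
  rw [lintegral_mul_convMeas_comm hF hG, ← hG1, ← lintegral_ofReal_sub_right G x]
  refine lintegral_congr_ae ?_
  filter_upwards [h] with z hz
  rw [hz, mul_one]

lemma ae_convMeas_eq_one {n : ℕ} {F G : (Fin n → ℝ) → ℝ}
    (hF : Measurable F) (hG : Measurable G)
    (hF1 : ∫⁻ x, ENNReal.ofReal (F x) = 1) (hG1 : ∫⁻ x, ENNReal.ofReal (G x) = 1)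
    (μ : Measure (Fin n → ℝ)) (hGμ : ∀ᵐ x, convMeas G μ x ≤ 1)
    (h : ∀ᵐ x, convMeas F μ x = 1) : ∀ᵐ x, convMeas G μ x = 1 := by
  obtain ⟨S, hS, hSf, hmax⟩ := exists_maximal_sFinite_restrict_of_convMeas_le hG hG1 μ hGμ
  have hGS : ∀ᵐ x, convMeas G (μ.restrict S) x = convMeas G μ x :=
    hGμ.mono fun x hx => convMeas_restrict_eq hG hS hmax hx
  have hFS : ∀ᵐ x, convMeas F (μ.restrict S) x = 1 :=
    h.mono fun x hx => (convMeas_restrict_eq hF hS hmax hx.le).trans hx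
  have := ae_convMeas_eq_one_of_sFinite hF hG hF1 hG1 (μ.restrict S)
    (by filter_upwards [hGμ, hGS] with x hx hxS using hxS.trans_le hx) hFS
  filter_upwards [this, hGS] with x hx hxS using hxS.symm.trans hx

lemma lintegral_ofReal_eq_one {n : ℕ} {F : (Fin n → ℝ) → ℝ} (hF0 : ∀ x, 0 ≤ F x)
    (hF : Integrable F volume) (hF1 : ∫ x, F x = 1) : ∫⁻ x, ENNReal.ofReal (F x) = 1 := by
  rw [← ofReal_integral_eq_lintegral_ofReal hF (Filter.Eventually.of_forall hF0), hF1,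
    ENNReal.ofReal_one]

/-- Theorem 2.1: if `F, G ∈ L¹(ℝ^n)` are nonnegative with `∫F = ∫G = 1` and `μ` is a
positive Borel measure with `F∗μ ≤ 1` a.e. and `G∗μ ≤ 1` a.e., then `F∗μ = 1` a.e.
if and only if `G∗μ = 1` a.e. -/
theorem statement1 {n : ℕ} (F G : (Fin n → ℝ) → ℝ)
    (hFmeas : Measurable F) (hGmeas : Measurable G)
    (hF0 : ∀ x, 0 ≤ F x) (hG0 : ∀ x, 0 ≤ G x)
    (hFint : Integrable F volume) (hGint : Integrable G volume)
    (hF1 : (∫ x : Fin n → ℝ, F x) = 1) (hG1 : (∫ x : Fin n → ℝ, G x) = 1)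
    (μ : Measure (Fin n → ℝ))
    (hFμ : ∀ᵐ x : Fin n → ℝ, convMeas F μ x ≤ 1)
    (hGμ : ∀ᵐ x : Fin n → ℝ, convMeas G μ x ≤ 1) :
    (∀ᵐ x : Fin n → ℝ, convMeas F μ x = 1) ↔
      (∀ᵐ x : Fin n → ℝ, convMeas G μ x = 1) := by
  have hF1' := lintegral_ofReal_eq_one hF0 hFint hF1
  have hG1' := lintegral_ofReal_eq_one hG0 hGint hG1
  exact ⟨ae_convMeas_eq_one hFmeas hGmeas hF1' hG1' μ hGμ,
    ae_convMeas_eq_one hGmeas hFmeas hG1' hF1' μ hFμ⟩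
end
end

section
/- Let g₁ = χ_{[0,1]} on ℝ. The short-time Fourier transform V_{g₁}g₁(t,ν) vanishes at (t,ν) ∈ ℝ² if and only if |t| ≥ 1 or ν(1−|t|) ∈ ℤ∖{0}; that is, 𝒵(V_{g₁}g₁) = {(t,ν) : |t| ≥ 1} ∪ {(t,ν) : ν(1−|t|) ∈ ℤ∖{0}}. -/
open MeasureTheory Set

noncomputable section

/-- the one-dimensional short-time Fourier transform
`V_g f(t,ν) = ∫ f(x) conj(g(x-t)) e^{-2πiνx} dx` -/
def STFT1 (g f : ℝ → ℂ) (p : ℝ × ℝ) : ℂ :=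
  ∫ x : ℝ, f x * starRingEnd ℂ (g (x - p.1)) *
    Complex.exp (-(2 * Real.pi * Complex.I * (x : ℂ) * (p.2 : ℂ)))

/-- the window `g₁ = χ_{[0,1]}` -/
def g1 : ℝ → ℂ := (Icc (0:ℝ) 1).indicator (fun _ => (1:ℂ))

/-- The ambiguity function of the unit window is an exponential integral over the overlap
of the interval `[0,1]` with its translate. -/
lemma STFT1_g1_g1 (t ν : ℝ) :
    STFT1 g1 g1 (t, ν) = ∫ x in Icc (max 0 t) (min 1 (t + 1)),
      Complex.exp (-(2 * Real.pi * Complex.I * ν) * x) := by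
  rw [← integral_indicator measurableSet_Icc]
  refine integral_congr_ae (.of_forall fun x => ?_)
  have hmem : x ∈ Icc (max 0 t) (min 1 (t + 1)) ↔ x ∈ Icc (0 : ℝ) 1 ∧ x - t ∈ Icc (0 : ℝ) 1 := by
    simp only [mem_Icc, max_le_iff, le_min_iff, sub_nonneg, sub_le_iff_le_add']
    tauto
  by_cases h₀ : x ∈ Icc (0 : ℝ) 1 <;> by_cases h₁ : x - t ∈ Icc (0 : ℝ) 1 <;>
    simp only [g1, indicator, hmem, h₀, h₁, and_true, and_false, if_true, if_false, map_one,
      map_zero, mul_one, mul_zero, zero_mul, one_mul]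
  congr 1
  ring

lemma min_sub_max_eq_one_sub_abs (t : ℝ) : min 1 (t + 1) - max 0 t = 1 - |t| := by
  rcases le_total 0 t with h | h
  · rw [min_eq_left (by linarith), max_eq_right h, abs_of_nonneg h]
  · rw [min_eq_right (by linarith), max_eq_left h, abs_of_nonpos h]
    ring

/-- A character of frequency `ν` integrates to zero over `[a,b]` exactly when the interval
contains a nonzero whole number of periods. -/
lemma intervalIntegral_exp_eq_zero_iff {a b : ℝ} (hab : a < b) (ν : ℝ) :
    ∫ x in a..b, Complex.exp (-(2 * Real.pi * Complex.I * ν) * x) = 0 ↔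
      ∃ k : ℤ, k ≠ 0 ∧ ν * (b - a) = k := by
  have hπ : (2 * Real.pi * Complex.I : ℂ) ≠ 0 := Complex.two_pi_I_ne_zero
  rcases eq_or_ne ν 0 with rfl | hν
  · have hba : (b : ℂ) - a ≠ 0 := by exact_mod_cast (sub_pos.2 hab).ne'
    simp [hba, eq_comm]
  · have hc : -(2 * Real.pi * Complex.I * ν : ℂ) ≠ 0 :=
      neg_ne_zero.2 (mul_ne_zero hπ (by exact_mod_cast hν))
    rw [integral_exp_mul_complex hc, div_eq_zero_iff, or_iff_left hc, sub_eq_zero, eq_comm,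
      Complex.exp_eq_exp_iff_exists_int]
    refine exists_congr fun k => ?_
    have hiff : -(2 * Real.pi * Complex.I * ν : ℂ) * a =
        -(2 * Real.pi * Complex.I * ν) * b + k * (2 * Real.pi * Complex.I) ↔
        ν * (b - a) = k := by
      rw [← Complex.ofReal_inj, ← mul_right_inj' (b := ((ν * (b - a) : ℝ) : ℂ)) hπ]
      push_cast
      constructor <;> intro h <;> linear_combination h
    rw [hiff, iff_and_self]
    rintro h rfl
    exact mul_ne_zero hν (sub_pos.2 hab).ne' (by simpa using h)

/-- Equation (2.2): the zero set of `V_{g₁}g₁` is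
`{(t,ν) : |t| ≥ 1} ∪ {(t,ν) : ν(1-|t|) ∈ ℤ ∖ {0}}`. -/
theorem statement5 :
    {p : ℝ × ℝ | STFT1 g1 g1 p = 0} =
      {p : ℝ × ℝ | 1 ≤ |p.1|} ∪
      {p : ℝ × ℝ | ∃ k : ℤ, k ≠ 0 ∧ p.2 * (1 - |p.1|) = (k : ℝ)} := by
  ext ⟨t, ν⟩
  simp only [mem_ofPred_eq, mem_union, STFT1_g1_g1, ← min_sub_max_eq_one_sub_abs]
  have hlen := min_sub_max_eq_one_sub_abs t
  rcases le_or_gt 1 |t| with ht | ht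
  · have hnull : volume (Icc (max 0 t) (min 1 (t + 1))) = 0 := by
      rw [Real.volume_Icc, ENNReal.ofReal_eq_zero]
      linarith
    exact iff_of_true (setIntegral_measure_zero _ hnull) (.inl ht)
  · have hlt : max 0 t < min 1 (t + 1) := by linarith
    rw [integral_Icc_eq_integral_Ioc, ← intervalIntegral.integral_of_le hlt.le,
      intervalIntegral_exp_eq_zero_iff hlt, or_iff_right ht.not_ge]
end
end

section
/- Suppose χ_{[0,1]²} + 𝒥 is a tiling of ℝ² with (0,0) ∈ 𝒥. Then 𝒥 has one of the following two forms: 𝒥 = ⋃_{k∈ℤ} (ℤ + a_k) × {k} or 𝒥 = ⋃_{k∈ℤ} {k} × (ℤ + a_k), where the a_k are real numbers in [0,1) for k ≠ 0 and a₀ = 0. -/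
open MeasureTheory Set
open scoped ENNReal

noncomputable section

/-- the unit square `[0,1]² ⊂ ℝ²` -/
def unitSq : Set (ℝ × ℝ) := Icc (0:ℝ) 1 ×ˢ Icc (0:ℝ) 1

/-- `χ_{[0,1]²} + 𝒥` is a tiling of `ℝ²`: `Σ_{t∈𝒥} χ_{[0,1]²}(x−t) = 1` for a.e. `x`. -/
def SqTiling (J : Set (ℝ × ℝ)) : Prop :=
  ∀ᵐ x : ℝ × ℝ, (∑' t : J, unitSq.indicator (fun _ => (1 : ℝ≥0∞)) (x - (t : ℝ × ℝ))) = 1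

/-- A set of positions of unit squares whose half-open squares `t + [0,1)²` partition the plane:
distinct squares do not overlap, and every point is covered. -/
structure IsSqPartition (J : Set (ℝ × ℝ)) : Prop where
  eq_of_overlap : ∀ {t s : ℝ × ℝ}, t ∈ J → s ∈ J → |t.1 - s.1| < 1 → |t.2 - s.2| < 1 → t = s
  cover : ∀ x y : ℝ, ∃ t ∈ J, t.1 ≤ x ∧ x < t.1 + 1 ∧ t.2 ≤ y ∧ y < t.2 + 1

/-- A separated set of positions has finitely many members in each box. -/
theorem finite_inter_box_of_separated {J : Set (ℝ × ℝ)}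
    (hs : ∀ {t s : ℝ × ℝ}, t ∈ J → s ∈ J → |t.1 - s.1| < 1 → |t.2 - s.2| < 1 → t = s)
    (a b c d : ℝ) : (J ∩ Icc a b ×ˢ Icc c d).Finite := by
  refine Set.Finite.of_injOn (f := fun t : ℝ × ℝ => (⌊t.1⌋, ⌊t.2⌋))
    (t := Icc ⌊a⌋ ⌊b⌋ ×ˢ Icc ⌊c⌋ ⌊d⌋) ?_ ?_ ((finite_Icc _ _).prod (finite_Icc _ _))
  · rintro t ⟨-, ht1, ht2⟩
    exact ⟨⟨Int.floor_mono ht1.1, Int.floor_mono ht1.2⟩,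
      ⟨Int.floor_mono ht2.1, Int.floor_mono ht2.2⟩⟩
  · rintro t ⟨ht, -⟩ s ⟨hs', -⟩ h
    simp only [Prod.mk.injEq] at h
    exact hs ht hs' (Int.abs_sub_lt_one_of_floor_eq_floor h.1)
      (Int.abs_sub_lt_one_of_floor_eq_floor h.2)

/-- A separated set of closed squares covering a dense set of points partitions the plane. -/
theorem IsSqPartition.of_dense {J : Set (ℝ × ℝ)}
    (hs : ∀ {t s : ℝ × ℝ}, t ∈ J → s ∈ J → |t.1 - s.1| < 1 → |t.2 - s.2| < 1 → t = s)
    (hd : ∀ x y ε : ℝ, 0 < ε → ∃ x' ∈ Ioo x (x + ε), ∃ y' ∈ Ioo y (y + ε),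
      ∃ t ∈ J, t.1 ≤ x' ∧ x' ≤ t.1 + 1 ∧ t.2 ≤ y' ∧ y' ≤ t.2 + 1) :
    IsSqPartition J := by
  refine ⟨hs, fun x y => ?_⟩
  have hfin := finite_inter_box_of_separated hs (x - 1) (x + 1) (y - 1) (y + 1)
  have key : ∀ z w : ℝ, ∀ᶠ ε in nhdsWithin (0 : ℝ) (Ioi 0), z < w → z + ε ≤ w := by
    intro z w
    by_cases h : z < w
    · filter_upwards [Ioo_mem_nhdsGT (sub_pos.2 h)] with ε hε _
      linarith [hε.2]
    · exact Filter.Eventually.of_forall fun ε h' => absurd h' h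
  have hev : ∀ᶠ ε in nhdsWithin (0 : ℝ) (Ioi 0),
      ∀ t ∈ J ∩ Icc (x - 1) (x + 1) ×ˢ Icc (y - 1) (y + 1),
        (x < t.1 → x + ε ≤ t.1) ∧ (y < t.2 → y + ε ≤ t.2) :=
    (Filter.eventually_all_finite hfin).2 fun t _ => (key x t.1).and (key y t.2)
  obtain ⟨ε, hε, hε0, hε1⟩ := (hev.and (Ioo_mem_nhdsGT (zero_lt_one (α := ℝ)))).exists
  obtain ⟨x', hx, y', hy, t, ht, h1, h2, h3, h4⟩ := hd x y ε hε0
  obtain ⟨e1, e2⟩ := hε t ⟨ht, ⟨by linarith [hx.1], by linarith [hx.2]⟩,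
    ⟨by linarith [hy.1], by linarith [hy.2]⟩⟩
  refine ⟨t, ht, ?_, by linarith [hx.1], ?_, by linarith [hy.1]⟩
  · by_contra! h
    linarith [e1 h, hx.2]
  · by_contra! h
    linarith [e2 h, hy.2]

theorem mem_unitSq_sub {x t : ℝ × ℝ} :
    x - t ∈ unitSq ↔ t.1 ≤ x.1 ∧ x.1 ≤ t.1 + 1 ∧ t.2 ≤ x.2 ∧ x.2 ≤ t.2 + 1 := by
  simp only [unitSq, mem_prod, mem_Icc, Prod.fst_sub, Prod.snd_sub, sub_nonneg,
    sub_le_iff_le_add', and_assoc]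

theorem SqTiling.isSqPartition {J : Set (ℝ × ℝ)} (h : SqTiling J) : IsSqPartition J := by
  have hdense := Measure.dense_of_ae h
  apply IsSqPartition.of_dense
  · intro t s ht hs h1 h2
    by_contra hne
    rw [abs_lt] at h1 h2
    obtain ⟨x, ⟨hx1, hx2⟩, hx⟩ := hdense.inter_open_nonempty
      (Ioo (max t.1 s.1) (min t.1 s.1 + 1) ×ˢ Ioo (max t.2 s.2) (min t.2 s.2 + 1))
      (isOpen_Ioo.prod isOpen_Ioo) (by
        refine Set.Nonempty.prod (nonempty_Ioo.2 ?_) (nonempty_Ioo.2 ?_)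
        · rcases max_cases t.1 s.1 with ⟨e, _⟩ | ⟨e, _⟩ <;>
            rcases min_cases t.1 s.1 with ⟨e', _⟩ | ⟨e', _⟩ <;> rw [e, e'] <;> linarith
        · rcases max_cases t.2 s.2 with ⟨e, _⟩ | ⟨e, _⟩ <;>
            rcases min_cases t.2 s.2 with ⟨e', _⟩ | ⟨e', _⟩ <;> rw [e, e'] <;> linarith)
    simp only [mem_Ioo, max_lt_iff, ← sub_lt_iff_lt_add, lt_min_iff] at hx1 hx2
    have hne' : (⟨t, ht⟩ : J) ≠ ⟨s, hs⟩ := fun e => hne (congrArg Subtype.val e)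
    have hle := ENNReal.sum_le_tsum (f := fun t : J =>
      unitSq.indicator (fun _ => (1 : ℝ≥0∞)) (x - (t : ℝ × ℝ))) {⟨t, ht⟩, ⟨s, hs⟩}
    rw [Finset.sum_pair hne', hx.out,
      indicator_of_mem (mem_unitSq_sub.2 (by refine ⟨?_, ?_, ?_, ?_⟩ <;> linarith)),
      indicator_of_mem (mem_unitSq_sub.2 (by refine ⟨?_, ?_, ?_, ?_⟩ <;> linarith))] at hle
    norm_num at hle
  · intro x y ε hε
    obtain ⟨z, ⟨hz1, hz2⟩, hz⟩ := hdense.inter_open_nonempty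
      (Ioo x (x + ε) ×ˢ Ioo y (y + ε)) (isOpen_Ioo.prod isOpen_Ioo)
      ((nonempty_Ioo.2 (by linarith)).prod (nonempty_Ioo.2 (by linarith)))
    refine ⟨z.1, hz1, z.2, hz2, ?_⟩
    by_contra! hno
    refine zero_ne_one (α := ℝ≥0∞) ?_
    rw [← hz.out, eq_comm, ENNReal.tsum_eq_zero]
    rintro ⟨t, ht⟩
    refine indicator_of_notMem (fun hm => ?_) _
    obtain ⟨h1, h2, h3, h4⟩ := mem_unitSq_sub.1 hm
    exact absurd h4 (not_le.2 (hno t ht h1 h2 h3))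

namespace IsSqPartition

variable {J : Set (ℝ × ℝ)}

theorem neg (h : IsSqPartition J) : IsSqPartition {t | -t ∈ J} := by
  refine of_dense (fun {t s} ht hs h1 h2 => ?_) fun x y ε hε => ?_
  · refine neg_injective (h.eq_of_overlap ht hs ?_ ?_)
    · rwa [Prod.fst_neg, Prod.fst_neg, neg_sub_neg, abs_sub_comm]
    · rwa [Prod.snd_neg, Prod.snd_neg, neg_sub_neg, abs_sub_comm]
  · obtain ⟨t, ht, h1, h2, h3, h4⟩ := h.cover (1 - (x + ε / 2)) (1 - (y + ε / 2))
    refine ⟨x + ε / 2, ⟨by linarith, by linarith⟩, y + ε / 2, ⟨by linarith, by linarith⟩,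
      -t, by simpa using ht, ?_⟩
    simp only [Prod.fst_neg, Prod.snd_neg]
    refine ⟨?_, ?_, ?_, ?_⟩ <;> linarith

theorem swap (h : IsSqPartition J) : IsSqPartition {t | t.swap ∈ J} := by
  refine ⟨fun {t s} ht hs h1 h2 => Prod.swap_injective (h.eq_of_overlap ht hs h2 h1),
    fun x y => ?_⟩
  obtain ⟨t, ht, h1, h2, h3, h4⟩ := h.cover y x
  exact ⟨t.swap, by simpa using ht, h3, h4, h1, h2⟩

/-- The square resting on the upper left corner of a given one, shifted left by `e ∈ [0,1)`. -/
theorem exists_above (h : IsSqPartition J) {x y : ℝ} (ht : (x, y) ∈ J) :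
    ∃ e, 0 ≤ e ∧ e < 1 ∧ (x - e, y + 1) ∈ J := by
  obtain ⟨⟨a, b⟩, hu, h1, h2, h3, h4⟩ := h.cover x (y + 1)
  dsimp only at h1 h2 h3 h4
  have hb : b = y + 1 := by
    by_contra hb
    have hb := lt_of_le_of_ne h3 hb
    have := h.eq_of_overlap hu ht (by rw [abs_lt]; constructor <;> dsimp only <;> linarith)
      (by rw [abs_lt]; constructor <;> dsimp only <;> linarith)
    rw [Prod.mk.injEq] at this
    linarith
  exact ⟨x - a, by linarith, by linarith, by rwa [sub_sub_cancel, ← hb]⟩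

theorem exists_right (h : IsSqPartition J) {x y : ℝ} (ht : (x, y) ∈ J) :
    ∃ d, 0 ≤ d ∧ d < 1 ∧ (x + 1, y - d) ∈ J :=
  h.swap.exists_above (x := y) (y := x) ht

/-- If the right neighbour of a square is strictly lower, then the square above that neighbour is
aligned with it. -/
theorem right_step (h : IsSqPartition J) {x y d : ℝ} (ht : (x, y) ∈ J) (hd : 0 < d) (hd1 : d < 1)
    (hs : (x + 1, y - d) ∈ J) : (x + 1, y - d + 1) ∈ J := by
  obtain ⟨e, he0, he1, hw⟩ := h.exists_above hs
  rcases he0.eq_or_lt with rfl | he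
  · simpa using hw
  · have := h.eq_of_overlap hw ht (by rw [abs_lt]; constructor <;> dsimp only <;> linarith)
      (by rw [abs_lt]; constructor <;> dsimp only <;> linarith)
    rw [Prod.mk.injEq] at this
    linarith

theorem above_step (h : IsSqPartition J) {x y e : ℝ} (ht : (x, y) ∈ J) (he : 0 < e) (he1 : e < 1)
    (hs : (x - e, y + 1) ∈ J) : (x - e + 1, y + 1) ∈ J :=
  h.swap.right_step (x := y) (y := x) ht he he1 hs

/-- A square cannot have both its right and its upper neighbour shifted. -/
theorem not_both_shifted (h : IsSqPartition J) {x y d e : ℝ} (ht : (x, y) ∈ J) (hd : 0 < d)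
    (hd1 : d < 1) (hr : (x + 1, y - d) ∈ J) (he : 0 < e) (he1 : e < 1) (ha : (x - e, y + 1) ∈ J) :
    False := by
  have := h.eq_of_overlap (h.right_step ht hd hd1 hr) (h.above_step ht he he1 ha)
    (by rw [abs_lt]; constructor <;> dsimp only <;> linarith)
    (by rw [abs_lt]; constructor <;> dsimp only <;> linarith)
  rw [Prod.mk.injEq] at this
  linarith

/-- A vertical fault propagates upwards. -/
theorem fault_up (h : IsSqPartition J) {x y d : ℝ} (ht : (x, y) ∈ J) (hd : 0 < d)
    (hd1 : d < 1) (hr : (x + 1, y - d) ∈ J) (n : ℕ) :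
    (x, y + n) ∈ J ∧ (x + 1, y + n - d) ∈ J := by
  induction n with
  | zero => simpa using ⟨ht, hr⟩
  | succ n ih =>
    obtain ⟨h1, h2⟩ := ih
    obtain ⟨e, he0, he1, ha⟩ := h.exists_above h1
    rcases he0.eq_or_lt with rfl | he
    · push_cast
      refine ⟨by simpa [add_assoc] using ha, ?_⟩
      convert h.right_step h1 hd hd1 h2 using 2
      ring
    · exact (h.not_both_shifted h1 hd hd1 h2 he he1 ha).elim

/-- A vertical fault extends along a full line. -/
theorem fault_line (h : IsSqPartition J) {x y d : ℝ} (ht : (x, y) ∈ J) (hd : 0 < d)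
    (hd1 : d < 1) (hr : (x + 1, y - d) ∈ J) (n : ℤ) :
    (x, y + n) ∈ J ∧ (x + 1, y + n - d) ∈ J := by
  obtain ⟨n, rfl | rfl⟩ := n.eq_nat_or_neg
  · exact_mod_cast h.fault_up ht hd hd1 hr n
  · have := h.neg.fault_up (x := -(x + 1)) (y := -(y - d)) (d := d)
      (by simpa using hr) hd hd1 (by simpa using ht) n
    simp only [mem_ofPred_eq, Prod.neg_mk] at this
    obtain ⟨h1, h2⟩ := this
    push_cast
    constructor
    · convert h2 using 2 <;> ring
    · convert h1 using 2 <;> ring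

theorem fault_line_horizontal (h : IsSqPartition J) {x y e : ℝ} (ht : (x, y) ∈ J) (he : 0 < e)
    (he1 : e < 1) (ha : (x - e, y + 1) ∈ J) (n : ℤ) :
    (x + n, y) ∈ J ∧ (x + n - e, y + 1) ∈ J :=
  h.swap.fault_line (x := y) (y := x) ht he he1 ha n

theorem right_aligned_or_above_aligned (h : IsSqPartition J) :
    (∀ x y, (x, y) ∈ J → (x + 1, y) ∈ J) ∨ ∀ x y, (x, y) ∈ J → (x, y + 1) ∈ J := by
  by_contra! hcon
  obtain ⟨⟨x, y, ht, hr⟩, x', y', ht', ha⟩ := hcon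
  obtain ⟨d, hd0, hd1, hd⟩ := h.exists_right ht
  obtain ⟨e, he0, he1, he⟩ := h.exists_above ht'
  replace hd0 : 0 < d := hd0.lt_of_ne (by rintro rfl; simp_all)
  replace he0 : 0 < e := he0.lt_of_ne (by rintro rfl; simp_all)
  obtain ⟨c1, c2⟩ := h.fault_line ht hd0 hd1 hd ⌊y' - y⌋
  obtain ⟨r1, r2⟩ := h.fault_line_horizontal ht' he0 he1 he ⌊x - x'⌋
  have f1 := Int.floor_le (y' - y)
  have f2 := Int.lt_floor_add_one (y' - y)
  have f3 := Int.floor_le (x - x')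
  have f4 := Int.lt_floor_add_one (x - x')
  have heq := h.eq_of_overlap c1 r1 (by rw [abs_lt]; constructor <;> dsimp only <;> linarith)
    (by rw [abs_lt]; constructor <;> dsimp only <;> linarith)
  rw [Prod.mk.injEq] at heq
  rw [← heq.1] at r2
  rw [← heq.2] at r2
  exact h.not_both_shifted c1 hd0 hd1 c2 he0 he1 r2

section Rows

variable (h : IsSqPartition J) (hr : ∀ x y, (x, y) ∈ J → (x + 1, y) ∈ J)
include h hr

theorem add_int_mem {x y : ℝ} (ht : (x, y) ∈ J) (n : ℤ) : (x + n, y) ∈ J := by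
  induction n using Int.induction_on with
  | zero => simpa using ht
  | succ n ih => simpa [add_assoc] using hr _ _ ih
  | pred n ih =>
    obtain ⟨⟨a, b⟩, hu, h1, h2, h3, h4⟩ := h.cover (x + ((-n : ℤ) : ℝ) - 1) y
    dsimp only at h1 h2 h3 h4
    have := h.eq_of_overlap (hr _ _ hu) ih
      (by rw [abs_lt]; constructor <;> dsimp only <;> linarith)
      (by rw [abs_lt]; constructor <;> dsimp only <;> linarith)
    rw [Prod.mk.injEq] at this
    obtain ⟨e1, rfl⟩ := this
    convert hu using 2
    push_cast at e1 ⊢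
    linarith

/-- Squares whose heights differ by less than one lie in the same row. -/
theorem same_row {x y x' y' : ℝ} (ht : (x, y) ∈ J) (hs : (x', y') ∈ J) (hy : |y - y'| < 1) :
    y = y' ∧ x = x' + ⌊x - x'⌋ := by
  have f3 := Int.floor_le (x - x')
  have f4 := Int.lt_floor_add_one (x - x')
  have := h.eq_of_overlap ht (h.add_int_mem hr hs ⌊x - x'⌋)
    (by rw [abs_lt]; constructor <;> dsimp only <;> linarith) hy
  rw [Prod.mk.injEq] at this
  exact ⟨this.2, this.1⟩

theorem exists_mem_row (h0 : ((0 : ℝ), (0 : ℝ)) ∈ J) (k : ℤ) : ∃ x : ℝ, (x, (k : ℝ)) ∈ J := by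
  induction k using Int.induction_on with
  | zero => exact ⟨0, by simpa using h0⟩
  | succ k ih =>
    obtain ⟨x, hx⟩ := ih
    obtain ⟨e, -, -, he⟩ := h.exists_above hx
    exact ⟨x - e, by simpa using he⟩
  | pred k ih =>
    obtain ⟨x, hx⟩ := ih
    obtain ⟨⟨a, b⟩, hu, h1, h2, h3, h4⟩ := h.cover x (((-k : ℤ) : ℝ) - 1)
    dsimp only at h1 h2 h3 h4
    obtain ⟨e, -, -, he⟩ := h.exists_above hu
    obtain ⟨e1, -⟩ := h.same_row hr he hx (by rw [abs_lt]; constructor <;> linarith)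
    refine ⟨a, ?_⟩
    convert hu using 2
    push_cast at e1 ⊢
    linarith

theorem exists_offsets (h0 : ((0 : ℝ), (0 : ℝ)) ∈ J) :
    ∃ a : ℤ → ℝ, a 0 = 0 ∧ (∀ k : ℤ, k ≠ 0 → a k ∈ Ico (0 : ℝ) 1) ∧
      J = {p : ℝ × ℝ | ∃ m k : ℤ, p = ((m : ℝ) + a k, (k : ℝ))} := by
  choose f hf using h.exists_mem_row hr h0
  refine ⟨fun k => Int.fract (f k), ?_,
    fun k _ => ⟨Int.fract_nonneg _, Int.fract_lt_one _⟩, ?_⟩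
  · obtain ⟨-, e⟩ := h.same_row hr (hf 0) h0 (by simp)
    dsimp only
    rw [e]
    simp
  · ext ⟨x, y⟩
    constructor
    · intro ht
      have f1 := Int.floor_le y
      have f2 := Int.lt_floor_add_one y
      obtain ⟨e1, e2⟩ := h.same_row hr ht (hf ⌊y⌋) (by rw [abs_lt]; constructor <;> linarith)
      refine ⟨⌊f ⌊y⌋⌋ + ⌊x - f ⌊y⌋⌋, ⌊y⌋, Prod.ext ?_ e1⟩
      have := Int.floor_add_fract (f ⌊y⌋)
      push_cast
      linarith
    · rintro ⟨m, k, e⟩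
      rw [e]
      convert h.add_int_mem hr (hf k) (m - ⌊f k⌋) using 2
      dsimp only
      rw [← Int.self_sub_floor]
      push_cast
      ring

end Rows

end IsSqPartition

/-- Proposition 3.2: if `χ_{[0,1]²} + 𝒥` tiles `ℝ²` and `(0,0) ∈ 𝒥`, then
`𝒥 = ⋃_{k∈ℤ} (ℤ + a_k) × {k}` or `𝒥 = ⋃_{k∈ℤ} {k} × (ℤ + a_k)`,
with `a_k ∈ [0,1)` for `k ≠ 0` and `a₀ = 0`. -/
theorem statement8 (J : Set (ℝ × ℝ)) (hJc : J.Countable)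
    (h0 : ((0:ℝ), (0:ℝ)) ∈ J) (htile : SqTiling J) :
    ∃ a : ℤ → ℝ, a 0 = 0 ∧ (∀ k : ℤ, k ≠ 0 → a k ∈ Ico (0:ℝ) 1) ∧
      (J = {p : ℝ × ℝ | ∃ m k : ℤ, p = ((m : ℝ) + a k, (k : ℝ))} ∨
       J = {p : ℝ × ℝ | ∃ m k : ℤ, p = ((k : ℝ), (m : ℝ) + a k)}) := by
  have h := htile.isSqPartition
  rcases h.right_aligned_or_above_aligned with hr | ha
  · obtain ⟨a, ha0, ha1, hJ⟩ := h.exists_offsets hr h0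
    exact ⟨a, ha0, ha1, Or.inl hJ⟩
  · obtain ⟨a, ha0, ha1, hJ⟩ := h.swap.exists_offsets (fun x y ht => ha y x ht) h0
    refine ⟨a, ha0, ha1, Or.inr ?_⟩
    ext ⟨x, y⟩
    have := Set.ext_iff.1 hJ (y, x)
    simpa [and_comm] using this
end
end

section
/- Let 𝒥 ⊂ ℝ² be a nonempty countable set such that 𝒥 + [0,1]² is a packing of ℝ² (the translates [0,1]²+t, t ∈ 𝒥, are pairwise essentially disjoint). Suppose that for every t ∈ 𝒥 and every x ∈ ∂(t + [0,1]²) there exists t_x ∈ 𝒥 with t_x ≠ t such that x ∈ ∂(t_x + [0,1]²). Then 𝒥 + [0,1]² is a tiling of ℝ², i.e., ⋃_{t∈𝒥}(t+[0,1]²) = ℝ². -/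
open MeasureTheory Set
open scoped ENNReal Pointwise

noncomputable section

lemma vadd_unitSq (t : ℝ × ℝ) :
    t +ᵥ unitSq = Icc t.1 (t.1 + 1) ×ˢ Icc t.2 (t.2 + 1) := by
  ext x
  simp only [mem_vadd_set_iff_neg_vadd_mem, unitSq, mem_prod, mem_Icc, vadd_eq_add, Prod.fst_add,
    Prod.snd_add, Prod.fst_neg, Prod.snd_neg]
  constructor <;> rintro ⟨⟨_, _⟩, _, _⟩ <;> refine ⟨⟨?_, ?_⟩, ?_, ?_⟩ <;> linarith

lemma frontier_vadd_unitSq (t : ℝ × ℝ) :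
    frontier (t +ᵥ unitSq) = Icc t.1 (t.1 + 1) ×ˢ {t.2, t.2 + 1} ∪
      {t.1, t.1 + 1} ×ˢ Icc t.2 (t.2 + 1) := by
  rw [vadd_unitSq, frontier_prod_eq, frontier_Icc (by linarith), frontier_Icc (by linarith),
    closure_Icc, closure_Icc]

lemma frontier_vadd_unitSq_subset (t : ℝ × ℝ) :
    frontier (t +ᵥ unitSq) ⊆ Icc t.1 (t.1 + 1) ×ˢ Icc t.2 (t.2 + 1) := by
  rw [vadd_unitSq]
  exact (isClosed_Icc.prod isClosed_Icc).frontier_subset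

/-- Translates of the unit square by vectors at sup-distance less than `1` overlap. -/
lemma volume_vadd_unitSq_inter_ne_zero {t t' : ℝ × ℝ} (h₁ : |t.1 - t'.1| < 1)
    (h₂ : |t.2 - t'.2| < 1) : volume ((t +ᵥ unitSq) ∩ (t' +ᵥ unitSq)) ≠ 0 := by
  rw [abs_lt] at h₁ h₂
  rw [vadd_unitSq, vadd_unitSq, prod_inter_prod, Icc_inter_Icc, Icc_inter_Icc,
    Measure.volume_eq_prod, Measure.prod_prod, Real.volume_Icc, Real.volume_Icc]
  refine mul_ne_zero ?_ ?_ <;>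
  · simp only [ne_eq, ENNReal.ofReal_eq_zero, not_le, sub_pos, sup_lt_iff, lt_inf_iff]
    refine ⟨⟨?_, ?_⟩, ?_, ?_⟩ <;> linarith

/-- In a packing by unit squares with lower left corners `P`, if a vertical line `c` and an interval
`(b, b + 1)` are such that each `(c, z)` with `z ∈ (b, b + 1)` is on the left side of a square, then
each `y ∈ [b, b + 1)` is in the half-open left side of one of these squares. -/
lemma exists_half_open_of_forall_Ioo {P : ℝ → ℝ → Prop} {b c y : ℝ}
    (hsep : ∀ a b a' b', P a b → P a' b' → |a - a'| < 1 → |b - b'| < 1 → a = a' ∧ b = b')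
    (hc : ∀ z ∈ Ioo b (b + 1), ∃ b', P c b' ∧ z ∈ Icc b' (b' + 1))
    (hy : y ∈ Ico b (b + 1)) : ∃ b', P c b' ∧ y ∈ Ico b' (b' + 1) := by
  obtain ⟨hy₁, hy₂⟩ := hy
  obtain ⟨z, hyz, hz⟩ := exists_between hy₂
  obtain ⟨d, hd, hdz, hzd⟩ := hc z ⟨by linarith, hz⟩
  rcases le_or_gt d y with hdy | hdy
  · exact ⟨d, hd, hdy, by linarith⟩
  obtain ⟨w, hyw, hwd⟩ := exists_between hdy
  obtain ⟨e, he, hew, hwe⟩ := hc w ⟨by linarith, by linarith⟩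
  have hde : 1 ≤ d - e := by
    by_contra! h
    have := (hsep c d c e hd he (by simp) (by rw [abs_lt]; constructor <;> linarith)).2
    linarith
  exact ⟨e, he, by linarith, by linarith⟩

/-- In a packing by unit squares with lower left corners `P` where each point of a vertical side of a
square is in another square, every row meeting a half-open square is covered by half-open squares. -/
lemma exists_mem_row {P : ℝ → ℝ → Prop}
    (hsep : ∀ a b a' b', P a b → P a' b' → |a - a'| < 1 → |b - b'| < 1 → a = a' ∧ b = b')
    (hadj : ∀ a b c z, P a b → (c = a ∨ c = a + 1) → z ∈ Icc b (b + 1) →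
      ∃ a' b', P a' b' ∧ ¬(a = a' ∧ b = b') ∧ c ∈ Icc a' (a' + 1) ∧ z ∈ Icc b' (b' + 1))
    {a b y : ℝ} (hab : P a b) (hy : y ∈ Ico b (b + 1)) (x : ℝ) :
    ∃ a' b', P a' b' ∧ x ∈ Ico a' (a' + 1) ∧ y ∈ Ico b' (b' + 1) := by
  have far {a b a' b' z : ℝ} (h : P a b) (h' : P a' b') (hne : ¬(a = a' ∧ b = b'))
      (hz : z ∈ Ioo b (b + 1)) (hz' : z ∈ Icc b' (b' + 1)) : 1 ≤ |a - a'| := by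
    by_contra! hlt
    refine hne (hsep _ _ _ _ h h' hlt ?_)
    rw [abs_lt]
    constructor <;> linarith [hz.1, hz.2, hz'.1, hz'.2]
  have right (a : ℝ) (h : ∃ b, P a b ∧ y ∈ Ico b (b + 1)) :
      ∃ b, P (a + 1) b ∧ y ∈ Ico b (b + 1) := by
    obtain ⟨b, hab, hy⟩ := h
    refine exists_half_open_of_forall_Ioo hsep (fun z hz ↦ ?_) hy
    obtain ⟨a', b', h', hne, hx, hz'⟩ := hadj a b (a + 1) z hab (.inr rfl) (Ioo_subset_Icc_self hz)
    obtain rfl : a' = a + 1 := by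
      rcases le_abs.1 (far hab h' hne hz hz') with h | h <;> linarith [hx.1, hx.2]
    exact ⟨b', h', hz'⟩
  have left (a : ℝ) (h : ∃ b, P a b ∧ y ∈ Ico b (b + 1)) :
      ∃ b, P (a - 1) b ∧ y ∈ Ico b (b + 1) := by
    obtain ⟨b, hab, hy⟩ := h
    refine exists_half_open_of_forall_Ioo hsep (fun z hz ↦ ?_) hy
    obtain ⟨a', b', h', hne, hx, hz'⟩ := hadj a b a z hab (.inl rfl) (Ioo_subset_Icc_self hz)
    obtain rfl : a' = a - 1 := by
      rcases le_abs.1 (far hab h' hne hz hz') with h | h <;> linarith [hx.1, hx.2]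
    exact ⟨b', h', hz'⟩
  have all (n : ℤ) : ∃ b, P (a + n) b ∧ y ∈ Ico b (b + 1) := by
    induction n using Int.induction_on with
    | zero => exact ⟨b, by simpa using hab, hy⟩
    | succ n ih => simpa [add_assoc] using right _ ih
    | pred n ih => simpa [add_sub_assoc] using left _ ih
  obtain ⟨b', h', hy'⟩ := all ⌊x - a⌋
  exact ⟨_, b', h', ⟨by linarith [Int.floor_le (x - a)], by linarith [Int.lt_floor_add_one (x - a)]⟩,
    hy'⟩

/-- Proof of Corollary 4.3: if `𝒥 + [0,1]²` is a nonempty packing of `ℝ²` (pairwise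
essentially disjoint translates) such that every boundary point of each square
`t + [0,1]²`, `t ∈ 𝒥`, lies on the boundary of another square `t_x + [0,1]²` with
`t_x ∈ 𝒥`, `t_x ≠ t`, then `𝒥 + [0,1]²` is a tiling of `ℝ²`, i.e.
`⋃_{t∈𝒥}(t+[0,1]²) = ℝ²`. -/
theorem statement16 (J : Set (ℝ × ℝ)) (hJc : J.Countable) (hJne : J.Nonempty)
    (hpack : ∀ t ∈ J, ∀ t' ∈ J, t ≠ t' → volume ((t +ᵥ unitSq) ∩ (t' +ᵥ unitSq)) = 0)
    (hbd : ∀ t ∈ J, ∀ x ∈ frontier (t +ᵥ unitSq),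
      ∃ tx ∈ J, tx ≠ t ∧ x ∈ frontier (tx +ᵥ unitSq)) :
    (⋃ t ∈ J, t +ᵥ unitSq) = univ := by
  have hsep : ∀ a b a' b', (a, b) ∈ J → (a', b') ∈ J → |a - a'| < 1 → |b - b'| < 1 →
      a = a' ∧ b = b' := by
    intro a b a' b' h h' h₁ h₂
    by_contra hne
    exact volume_vadd_unitSq_inter_ne_zero (t := (a, b)) (t' := (a', b')) h₁ h₂
      (hpack _ h _ h' fun heq ↦ hne (Prod.ext_iff.1 heq))
  have hadj : ∀ t ∈ J, ∀ x ∈ frontier (t +ᵥ unitSq), ∃ a' b', (a', b') ∈ J ∧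
      ¬(t.1 = a' ∧ t.2 = b') ∧ x.1 ∈ Icc a' (a' + 1) ∧ x.2 ∈ Icc b' (b' + 1) := by
    intro t ht x hx
    obtain ⟨⟨a', b'⟩, h', hne, hx'⟩ := hbd t ht x hx
    have hmem := frontier_vadd_unitSq_subset _ hx'
    exact ⟨a', b', h', fun h ↦ hne (Prod.ext h.1.symm h.2.symm), hmem.1, hmem.2⟩
  obtain ⟨⟨a, b⟩, hab⟩ := hJne
  refine eq_univ_of_forall fun ⟨x, y⟩ ↦ ?_
  obtain ⟨c, d, hcd, hx, -⟩ := exists_mem_row (P := fun a b ↦ (a, b) ∈ J) hsep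
    (fun a b c z h hc hz ↦ hadj (a, b) h (c, z) (by
      rw [frontier_vadd_unitSq]
      exact .inr ⟨hc, hz⟩)) hab (y := b) ⟨le_rfl, by linarith⟩ x
  obtain ⟨f, e, hef, hy, hx⟩ := exists_mem_row (P := fun b a ↦ (a, b) ∈ J)
    (fun b a b' a' h h' hb ha ↦ (hsep a b a' b' h h' ha hb).symm)
    (fun b a c z h hc hz ↦ by
      obtain ⟨a', b', h', hne, hz', hc'⟩ := hadj (a, b) h (z, c) (by
        rw [frontier_vadd_unitSq]
        exact .inl ⟨hz, hc⟩)
      exact ⟨b', a', h', fun h ↦ hne h.symm, hc', hz'⟩) hcd hx y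
  refine mem_biUnion hef ?_
  rw [vadd_unitSq]
  exact ⟨Ico_subset_Icc_self hx, Ico_subset_Icc_self hy⟩
end
end
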